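/- Let n ≥ 8 and let 𝒻 be a family of 3-element subsets of [n] that shatters no 3-element subset, with |𝒻| ≥ C(n−1, 2) + 2. Assume that every family of 3-element subsets of an (n−1)-element set that shatters no 3-element subset has size at most C(n−2, 2) + 1. Let W be a maximal witness assignment for 𝒻 and set 𝒞 := {F ∈ 𝒻 : W(F) = ∅}. If 𝒞 is nonempty, some 2-element subset of [n] intersects every member of 𝒞, but no single element of [n] lies in every member of 𝒞 (i.e., the transversal number of 𝒞 equals 2), then |𝒞| ≥ 7. -/

import Mathlib

/-- A family `𝒻` shatters a set `S` if every subset of `S` is the trace of some member of `𝒻`. -/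
def Shatters (𝒻 : Finset (Finset ℕ)) (S : Finset ℕ) : Prop :=
  ∀ T ⊆ S, ∃ F ∈ 𝒻, F ∩ S = T

/-- `W` is a maximal witness assignment for `𝒻`. -/
def MaximalWitness (𝒻 : Finset (Finset ℕ)) (W : Finset ℕ → Finset ℕ) : Prop :=
  ∀ F ∈ 𝒻, W F ⊂ F ∧ (∀ G ∈ 𝒻, G ∩ F ≠ W F) ∧
    ∀ B : Finset ℕ, B ⊂ F → (W F).card < B.card → ∃ G ∈ 𝒻, G ∩ F = B

/-- The graph formed by the pairs completing `x` to a member of `𝒻`. -/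
def linkGraph (𝒻 : Finset (Finset ℕ)) (x : ℕ) : Finset (Finset ℕ) :=
  (𝒻.filter (fun F => x ∈ F)).image (fun F => F.erase x)

theorem Shatters.mono {𝒻 𝒢 : Finset (Finset ℕ)} {S : Finset ℕ} (h : 𝒢 ⊆ 𝒻)
    (hS : Shatters 𝒢 S) : Shatters 𝒻 S := fun T hT =>
  let ⟨F, hF, hFT⟩ := hS T hT
  ⟨F, h hF, hFT⟩

theorem card_linkGraph (𝒻 : Finset (Finset ℕ)) (x : ℕ) :
    (linkGraph 𝒻 x).card = (𝒻.filter (fun F => x ∈ F)).card := by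
  refine Finset.card_image_of_injOn fun F hF G hG h => ?_
  have hF' : x ∈ F := by simpa using (Finset.mem_filter.1 hF).2
  have hG' : x ∈ G := by simpa using (Finset.mem_filter.1 hG).2
  rw [← Finset.insert_erase hF', ← Finset.insert_erase hG']
  exact congrArg (insert x) h

theorem mem_linkGraph {𝒻 : Finset (Finset ℕ)} {x : ℕ} {E : Finset ℕ} :
    E ∈ linkGraph 𝒻 x ↔ x ∉ E ∧ insert x E ∈ 𝒻 := by
  constructor
  · intro h
    obtain ⟨F, hF, rfl⟩ := Finset.mem_image.1 h
    obtain ⟨hF, hx⟩ := Finset.mem_filter.1 hF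
    exact ⟨Finset.notMem_erase x F, by rwa [Finset.insert_erase hx]⟩
  · rintro ⟨hx, hE⟩
    exact Finset.mem_image.2
      ⟨_, Finset.mem_filter.2 ⟨hE, Finset.mem_insert_self x E⟩, Finset.erase_insert hx⟩

/-- Deleting a vertex and applying the bound on `n - 1` points bounds all degrees from below. -/
theorem le_card_linkGraph {n : ℕ} (hn : 2 ≤ n) {𝒻 : Finset (Finset ℕ)}
    (hsub : ∀ F ∈ 𝒻, F ⊆ Finset.Icc 1 n) (hcard : ∀ F ∈ 𝒻, F.card = 3)
    (hVC : ∀ S ⊆ Finset.Icc 1 n, S.card = 3 → ¬ Shatters 𝒻 S)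
    (hbig : (n - 1).choose 2 + 2 ≤ 𝒻.card)
    (ih : ∀ (V : Finset ℕ) (𝒢 : Finset (Finset ℕ)), V.card = n - 1 →
      (∀ G ∈ 𝒢, G ⊆ V) → (∀ G ∈ 𝒢, G.card = 3) →
      (∀ S ⊆ V, S.card = 3 → ¬ Shatters 𝒢 S) →
      𝒢.card ≤ (n - 2).choose 2 + 1)
    {x : ℕ} (hx : x ∈ Finset.Icc 1 n) : n - 1 ≤ (linkGraph 𝒻 x).card := by
  have hdel := ih ((Finset.Icc 1 n).erase x) (𝒻.filter (fun F => ¬ x ∈ F))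
    (by rw [Finset.card_erase_of_mem hx]; simp)
    (fun G hG => Finset.subset_erase.2
      ⟨hsub G (Finset.mem_filter.1 hG).1, (Finset.mem_filter.1 hG).2⟩)
    (fun G hG => hcard G (Finset.mem_filter.1 hG).1)
    (fun S hS hS3 h => hVC S (hS.trans (Finset.erase_subset _ _)) hS3
      (h.mono (Finset.filter_subset _ _)))
  have hsplit := Finset.card_filter_add_card_filter_not (s := 𝒻) (fun F => x ∈ F)
  rw [card_linkGraph]
  obtain ⟨m, rfl⟩ := Nat.exists_eq_add_of_le' hn
  have hpascal : (m + 2 - 1).choose 2 = m + (m + 2 - 2).choose 2 := by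
    simp [Nat.choose_succ_succ' m 1]
  omega

theorem eq_pair_of_card_eq_two {E : Finset ℕ} (hE : E.card = 2) {s t : ℕ} (hs : s ∈ E)
    (ht : t ∈ E) (hst : s ≠ t) : E = {s, t} :=
  (Finset.eq_of_subset_of_card_le (by simp [Finset.insert_subset_iff, hs, ht])
    (by rw [hE, Finset.card_pair hst])).symm

theorem exists_mem_Icc_notMem {n : ℕ} {U : Finset ℕ} (h : U.card < n) :
    ∃ x ∈ Finset.Icc 1 n, x ∉ U :=
  Finset.exists_mem_notMem_of_card_lt_card (by simpa using h)

/-- The pairs meeting each edge of a triangle with a private vertex added to each edge. -/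
theorem cover_triangle {E : Finset ℕ} (hE : E.card = 2) {p q r a b c : ℕ}
    (hd : [p, q, r, a, b, c].Nodup) (hA : p ∈ E ∨ q ∈ E ∨ a ∈ E)
    (hB : p ∈ E ∨ r ∈ E ∨ b ∈ E) (hC : q ∈ E ∨ r ∈ E ∨ c ∈ E) :
    E ∈ ({{p, q}, {p, r}, {q, r}, {p, c}, {q, b}, {r, a}} : Finset (Finset ℕ)) := by
  simp only [List.nodup_cons, List.mem_cons, List.not_mem_nil, not_or] at hd
  by_contra hcon
  simp only [Finset.mem_insert, Finset.mem_singleton, not_or] at hcon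
  obtain ⟨cpq, cpr, cqr, cpc, cqb, cra⟩ := hcon
  obtain ⟨⟨dpq, dpr, -, -, dpc, -⟩, ⟨dqr, -, dqb, -, -⟩, ⟨dra, -, -, -⟩, ⟨dab, dac, -⟩, ⟨dbc, -⟩, -⟩ := hd
  have key : ∀ {s t}, s ≠ t → E ≠ {s, t} → s ∈ E → t ∉ E :=
    fun hst hne hs ht => hne (eq_pair_of_card_eq_two hE hs ht hst)
  have hpq := key dpq cpq
  have hpr := key dpr cpr
  have hqr := key dqr cqr
  have hpc := key dpc cpc
  have hqb := key dqb cqb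
  have hra := key dra cra
  have habc : a ∈ E ∧ b ∈ E ∧ c ∈ E := by grind
  have hab := eq_pair_of_card_eq_two hE habc.1 habc.2.1 dab
  have hc : c ∈ ({a, b} : Finset ℕ) := hab ▸ habc.2.2
  simp only [Finset.mem_insert, Finset.mem_singleton] at hc
  exact hc.elim (Ne.symm dac) (Ne.symm dbc)

/-- The pairs meeting each of `{p, s, q}`, `{p, s, r}` and `{q, r, c}`. -/
theorem cover_kite {E : Finset ℕ} (hE : E.card = 2) {p s q r c : ℕ}
    (hd : [p, s, q, r, c].Nodup) (hA : p ∈ E ∨ s ∈ E ∨ q ∈ E)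
    (hB : p ∈ E ∨ s ∈ E ∨ r ∈ E) (hC : q ∈ E ∨ r ∈ E ∨ c ∈ E) :
    E ∈ ({{p, q}, {p, r}, {p, c}, {s, q}, {s, r}, {s, c}, {q, r}} : Finset (Finset ℕ)) := by
  simp only [List.nodup_cons, List.mem_cons, List.not_mem_nil, not_or] at hd
  by_contra hcon
  simp only [Finset.mem_insert, Finset.mem_singleton, not_or] at hcon
  obtain ⟨cpq, cpr, cpc, csq, csr, csc, cqr⟩ := hcon
  obtain ⟨⟨-, dpq, dpr, dpc, -⟩, ⟨dsq, dsr, dsc, -⟩, ⟨dqr, -, -⟩, ⟨-, -⟩, -⟩ := hd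
  have key : ∀ {s t}, s ≠ t → E ≠ {s, t} → s ∈ E → t ∉ E :=
    fun hst hne hs ht => hne (eq_pair_of_card_eq_two hE hs ht hst)
  have hpq := key dpq cpq
  have hpr := key dpr cpr
  have hpc := key dpc cpc
  have hsq := key dsq csq
  have hsr := key dsr csr
  have hsc := key dsc csc
  have hqr := key dqr cqr
  grind

/-- The pairs meeting each triple of a 4-element set. -/
theorem cover_tetrahedron {E : Finset ℕ} (hE : E.card = 2) {p q a b : ℕ}
    (hd : [p, q, a, b].Nodup) (hA : p ∈ E ∨ q ∈ E ∨ a ∈ E)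
    (hB : p ∈ E ∨ q ∈ E ∨ b ∈ E) (hC : q ∈ E ∨ a ∈ E ∨ b ∈ E) (hD : p ∈ E ∨ a ∈ E ∨ b ∈ E) :
    E ∈ ({{p, q}, {p, a}, {p, b}, {q, a}, {q, b}, {a, b}} : Finset (Finset ℕ)) := by
  simp only [List.nodup_cons, List.mem_cons, List.not_mem_nil, not_or] at hd
  by_contra hcon
  simp only [Finset.mem_insert, Finset.mem_singleton, not_or] at hcon
  obtain ⟨cpq, cpa, cpb, cqa, cqb, cab⟩ := hcon
  obtain ⟨⟨dpq, dpa, dpb, -⟩, ⟨dqa, dqb, -⟩, ⟨dab, -⟩, -⟩ := hd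
  have key : ∀ {s t}, s ≠ t → E ≠ {s, t} → s ∈ E → t ∉ E :=
    fun hst hne hs ht => hne (eq_pair_of_card_eq_two hE hs ht hst)
  have hpq := key dpq cpq
  have hpa := key dpa cpa
  have hpb := key dpb cpb
  have hqa := key dqa cqa
  have hqb := key dqb cqb
  have hab := key dab cab
  grind

/-- If the links of `x` and `y` contain a 4-cycle and its vertices avoid `x` and `y`, then
`{p, q, x}` is shattered, where `pq` is an edge of the cycle. -/
theorem shatters_of_four_cycle {𝒻 : Finset (Finset ℕ)} {p q s r x y : ℕ}
    (hd : [p, q, s, r, x, y].Nodup)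
    (h : ∀ z ∈ ({x, y} : Finset ℕ), {z, p, q} ∈ 𝒻 ∧ {z, p, r} ∈ 𝒻 ∧ {z, s, q} ∈ 𝒻 ∧ {z, s, r} ∈ 𝒻) :
    Shatters 𝒻 {p, q, x} := by
  simp only [List.nodup_cons, List.mem_cons, List.not_mem_nil, not_or] at hd
  obtain ⟨hxpq, hxpr, hxsq, hxsr⟩ := h x (by simp)
  obtain ⟨hypq, hypr, hysq, hysr⟩ := h y (by simp)
  intro T hT
  have hTmem : ∀ z ∈ T, z = p ∨ z = q ∨ z = x := fun z hz => by simpa using hT hz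
  by_cases hp : p ∈ T <;> by_cases hq : q ∈ T <;> by_cases hx : x ∈ T
  · exact ⟨_, hxpq, by ext z; have := hTmem z; simp; grind⟩
  · exact ⟨_, hypq, by ext z; have := hTmem z; simp; grind⟩
  · exact ⟨_, hxpr, by ext z; have := hTmem z; simp; grind⟩
  · exact ⟨_, hypr, by ext z; have := hTmem z; simp; grind⟩
  · exact ⟨_, hxsq, by ext z; have := hTmem z; simp; grind⟩
  · exact ⟨_, hysq, by ext z; have := hTmem z; simp; grind⟩
  · exact ⟨_, hxsr, by ext z; have := hTmem z; simp; grind⟩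
  · exact ⟨_, hysr, by ext z; have := hTmem z; simp; grind⟩

theorem card_of_mem_linkGraph {𝒻 : Finset (Finset ℕ)} (hcard : ∀ F ∈ 𝒻, F.card = 3) {x : ℕ}
    {E : Finset ℕ} (hE : E ∈ linkGraph 𝒻 x) : E.card = 2 := by
  obtain ⟨hx, hF⟩ := mem_linkGraph.1 hE
  have := hcard _ hF
  rw [Finset.card_insert_of_notMem hx] at this
  omega

/-- A triple avoiding `x` and meeting all members of `𝒻` meets all pairs of the link of `x`. -/
theorem meets_of_mem_linkGraph {𝒻 : Finset (Finset ℕ)} {x p q a : ℕ} {E : Finset ℕ}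
    (hE : E ∈ linkGraph 𝒻 x) (hA : ∀ F ∈ 𝒻, p ∈ F ∨ q ∈ F ∨ a ∈ F)
    (hp : p ≠ x) (hq : q ≠ x) (ha : a ≠ x) : p ∈ E ∨ q ∈ E ∨ a ∈ E := by
  simpa [hp, hq, ha] using hA _ (mem_linkGraph.1 hE).2

theorem not_meets_triangle {n : ℕ} (hn : 8 ≤ n) {𝒻 : Finset (Finset ℕ)}
    (hcard : ∀ F ∈ 𝒻, F.card = 3)
    (hdeg : ∀ x ∈ Finset.Icc 1 n, n - 1 ≤ (linkGraph 𝒻 x).card)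
    {p q r a b c : ℕ} (hd : [p, q, r, a, b, c].Nodup)
    (hA : ∀ F ∈ 𝒻, p ∈ F ∨ q ∈ F ∨ a ∈ F) (hB : ∀ F ∈ 𝒻, p ∈ F ∨ r ∈ F ∨ b ∈ F)
    (hC : ∀ F ∈ 𝒻, q ∈ F ∨ r ∈ F ∨ c ∈ F) : False := by
  obtain ⟨x, hxn, hx⟩ := exists_mem_Icc_notMem (n := n) (U := {p, q, r, a, b, c})
    (Finset.card_le_six.trans_lt (by omega))
  simp only [Finset.mem_insert, Finset.mem_singleton, not_or, ne_comm (a := x)] at hx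
  obtain ⟨hp, hq, hr, ha, hb, hc⟩ := hx
  have hle := (hdeg x hxn).trans (Finset.card_le_card fun E hE =>
    cover_triangle (card_of_mem_linkGraph hcard hE) hd
      (meets_of_mem_linkGraph hE hA hp hq ha) (meets_of_mem_linkGraph hE hB hp hr hb)
      (meets_of_mem_linkGraph hE hC hq hr hc))
  have := hle.trans Finset.card_le_six
  omega

theorem not_meets_tetrahedron {n : ℕ} (hn : 8 ≤ n) {𝒻 : Finset (Finset ℕ)}
    (hcard : ∀ F ∈ 𝒻, F.card = 3)
    (hdeg : ∀ x ∈ Finset.Icc 1 n, n - 1 ≤ (linkGraph 𝒻 x).card)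
    {p q a b : ℕ} (hd : [p, q, a, b].Nodup)
    (hA : ∀ F ∈ 𝒻, p ∈ F ∨ q ∈ F ∨ a ∈ F) (hB : ∀ F ∈ 𝒻, p ∈ F ∨ q ∈ F ∨ b ∈ F)
    (hC : ∀ F ∈ 𝒻, q ∈ F ∨ a ∈ F ∨ b ∈ F) (hD : ∀ F ∈ 𝒻, p ∈ F ∨ a ∈ F ∨ b ∈ F) : False := by
  obtain ⟨x, hxn, hx⟩ := exists_mem_Icc_notMem (n := n) (U := {p, q, a, b})
    (Finset.card_le_four.trans_lt (by omega))
  simp only [Finset.mem_insert, Finset.mem_singleton, not_or, ne_comm (a := x)] at hx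
  obtain ⟨hp, hq, ha, hb⟩ := hx
  have hle := (hdeg x hxn).trans (Finset.card_le_card fun E hE =>
    cover_tetrahedron (card_of_mem_linkGraph hcard hE) hd
      (meets_of_mem_linkGraph hE hA hp hq ha) (meets_of_mem_linkGraph hE hB hp hq hb)
      (meets_of_mem_linkGraph hE hC hq ha hb) (meets_of_mem_linkGraph hE hD hp ha hb))
  have := hle.trans Finset.card_le_six
  omega

/-- Here the link of a vertex off the three triples must consist of all seven pairs meeting them,
so that the links of two such vertices share a 4-cycle. -/
theorem not_meets_kite {n : ℕ} (hn : 8 ≤ n) {𝒻 : Finset (Finset ℕ)}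
    (hsub : ∀ F ∈ 𝒻, F ⊆ Finset.Icc 1 n) (hcard : ∀ F ∈ 𝒻, F.card = 3)
    (hVC : ∀ S ⊆ Finset.Icc 1 n, S.card = 3 → ¬ Shatters 𝒻 S)
    (hdeg : ∀ x ∈ Finset.Icc 1 n, n - 1 ≤ (linkGraph 𝒻 x).card)
    {p s q r c : ℕ} (hd : [p, s, q, r, c].Nodup)
    (hA : ∀ F ∈ 𝒻, p ∈ F ∨ s ∈ F ∨ q ∈ F) (hB : ∀ F ∈ 𝒻, p ∈ F ∨ s ∈ F ∨ r ∈ F)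
    (hC : ∀ F ∈ 𝒻, q ∈ F ∨ r ∈ F ∨ c ∈ F) : False := by
  obtain ⟨x, hxn, hx⟩ := exists_mem_Icc_notMem (n := n) (U := {p, s, q, r, c})
    (Finset.card_le_five.trans_lt (by omega))
  obtain ⟨y, hyn, hy⟩ := exists_mem_Icc_notMem (n := n) (U := {x, p, s, q, r, c})
    (Finset.card_le_six.trans_lt (by omega))
  rw [Finset.mem_insert, not_or] at hy
  obtain ⟨hyx, hy⟩ := hy
  have hmem : ∀ z ∈ Finset.Icc 1 n, z ∉ ({p, s, q, r, c} : Finset ℕ) →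
      {z, p, q} ∈ 𝒻 ∧ {z, p, r} ∈ 𝒻 ∧ {z, s, q} ∈ 𝒻 ∧ {z, s, r} ∈ 𝒻 := by
    intro z hzn hz
    simp only [Finset.mem_insert, Finset.mem_singleton, not_or, ne_comm (a := z)] at hz
    obtain ⟨hp, hs, hq, hr, hc⟩ := hz
    have heq := Finset.eq_of_subset_of_card_le (fun E hE =>
      cover_kite (card_of_mem_linkGraph hcard hE) hd
        (meets_of_mem_linkGraph hE hA hp hs hq) (meets_of_mem_linkGraph hE hB hp hs hr)
        (meets_of_mem_linkGraph hE hC hq hr hc))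
      ((Finset.card_insert_le _ _).trans
        ((Nat.succ_le_succ Finset.card_le_six).trans (by have := hdeg z hzn; omega)))
    refine ⟨?_, ?_, ?_, ?_⟩ <;> refine (mem_linkGraph.1 (?_ : _ ∈ linkGraph 𝒻 z)).2 <;>
      rw [heq] <;> simp
  have hpqx : ({p, q, x} : Finset ℕ).card = 3 := by
    rw [Finset.card_eq_three]
    simp at hd hx
    exact ⟨p, q, x, by tauto, by tauto, by tauto, rfl⟩
  refine hVC {p, q, x} (fun z hz => ?_) hpqx (shatters_of_four_cycle (s := s) (r := r) (y := y) ?_ ?_)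
  · refine hsub _ (hmem x hxn hx).1 ?_
    simp only [Finset.mem_insert, Finset.mem_singleton] at hz ⊢
    tauto
  · clear hmem hdeg hA hB hC
    simp at hd hx hy ⊢
    grind
  · intro z hz
    rcases Finset.mem_insert.1 hz with rfl | hz
    · exact hmem z hxn hx
    · rw [Finset.mem_singleton.1 hz]
      exact hmem y hyn hy

theorem exists_eq_triple_of_mem {A : Finset ℕ} (hA : A.card = 3) {p q : ℕ} (hp : p ∈ A)
    (hq : q ∈ A) (hpq : p ≠ q) : ∃ a, a ≠ p ∧ a ≠ q ∧ A = {p, q, a} := by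
  have hq' : q ∈ A.erase p := Finset.mem_erase.2 ⟨hpq.symm, hq⟩
  have hone : ((A.erase p).erase q).card = 1 := by
    rw [Finset.card_erase_of_mem hq', Finset.card_erase_of_mem hp, hA]
  obtain ⟨a, ha⟩ := Finset.card_eq_one.1 hone
  have hmem : a ∈ (A.erase p).erase q := ha ▸ Finset.mem_singleton_self a
  simp only [Finset.mem_erase] at hmem
  refine ⟨a, hmem.2.1, hmem.1, ?_⟩
  rw [← ha, Finset.insert_erase hq', Finset.insert_erase hp]

/-- Three pairwise intersecting triples, each meeting all of `𝒻`, have a common element. -/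
theorem exists_common_of_pairwise_meet {n : ℕ} (hn : 8 ≤ n) {𝒻 : Finset (Finset ℕ)}
    (hsub : ∀ F ∈ 𝒻, F ⊆ Finset.Icc 1 n) (hcard : ∀ F ∈ 𝒻, F.card = 3)
    (hVC : ∀ S ⊆ Finset.Icc 1 n, S.card = 3 → ¬ Shatters 𝒻 S)
    (hdeg : ∀ x ∈ Finset.Icc 1 n, n - 1 ≤ (linkGraph 𝒻 x).card)
    {A B C : Finset ℕ} (hA : A ∈ 𝒻) (hB : B ∈ 𝒻) (hC : C ∈ 𝒻)
    (mA : ∀ F ∈ 𝒻, ∃ z ∈ A, z ∈ F) (mB : ∀ F ∈ 𝒻, ∃ z ∈ B, z ∈ F)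
    (mC : ∀ F ∈ 𝒻, ∃ z ∈ C, z ∈ F) : ∃ z ∈ A, z ∈ B ∧ z ∈ C := by
  by_contra! hcon
  obtain ⟨p, hpA, hpB⟩ := mA B hB
  obtain ⟨q, hqA, hqC⟩ := mA C hC
  obtain ⟨r, hrB, hrC⟩ := mB C hC
  have hpC := hcon p hpA hpB
  have hqB : q ∉ B := fun h => hcon q hqA h hqC
  have hrA : r ∉ A := fun h => hcon r h hrB hrC
  have hpq : p ≠ q := fun h => hqB (h ▸ hpB)
  have hpr : p ≠ r := fun h => hrA (h ▸ hpA)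
  have hqr : q ≠ r := fun h => hrA (h ▸ hqA)
  obtain ⟨a, hap, haq, rfl⟩ := exists_eq_triple_of_mem (hcard A hA) hpA hqA hpq
  obtain ⟨b, hbp, hbr, rfl⟩ := exists_eq_triple_of_mem (hcard B hB) hpB hrB hpr
  obtain ⟨c, hcq, hcr, rfl⟩ := exists_eq_triple_of_mem (hcard C hC) hqC hrC hqr
  simp only [Finset.mem_insert, Finset.mem_singleton, not_or, exists_eq_or_imp,
    exists_eq_left] at hpC hqB hrA mA mB mC
  have hcab : ¬ (a = b ∧ b = c) := by
    rintro ⟨rfl, rfl⟩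
    exact hcon a (by simp) (by simp) (by simp)
  by_cases hab : a = b
  · subst hab
    exact not_meets_kite hn hsub hcard hVC hdeg (p := p) (s := a) (q := q) (r := r) (c := c)
      (by simp; grind) (by grind) (by grind) mC
  by_cases hac : a = c
  · subst hac
    exact not_meets_kite hn hsub hcard hVC hdeg (p := q) (s := a) (q := p) (r := r) (c := b)
      (by simp; grind) (by grind) (by grind) mB
  by_cases hbc : b = c
  · subst hbc
    exact not_meets_kite hn hsub hcard hVC hdeg (p := r) (s := b) (q := p) (r := q) (c := a)
      (by simp; grind) (by grind) (by grind) mA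
  exact not_meets_triangle hn hcard hdeg (p := p) (q := q) (r := r) (a := a) (b := b) (c := c)
    (by simp; grind) mA mB mC

/-- If `𝒞 = {F ∈ 𝒻 : W F = ∅}` is nonempty with transversal number exactly 2,
then `|𝒞| ≥ 7`. -/
theorem stmt_18 (n : ℕ) (hn : 8 ≤ n) (𝒻 : Finset (Finset ℕ))
    (hsub : ∀ F ∈ 𝒻, F ⊆ Finset.Icc 1 n) (hcard : ∀ F ∈ 𝒻, F.card = 3)
    (hVC : ∀ S ⊆ Finset.Icc 1 n, S.card = 3 → ¬ Shatters 𝒻 S)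
    (hbig : (n - 1).choose 2 + 2 ≤ 𝒻.card)
    (ih : ∀ (V : Finset ℕ) (𝒢 : Finset (Finset ℕ)), V.card = n - 1 →
      (∀ G ∈ 𝒢, G ⊆ V) → (∀ G ∈ 𝒢, G.card = 3) →
      (∀ S ⊆ V, S.card = 3 → ¬ Shatters 𝒢 S) →
      𝒢.card ≤ (n - 2).choose 2 + 1)
    (W : Finset ℕ → Finset ℕ) (hW : MaximalWitness 𝒻 W)
    (hne : (𝒻.filter (fun F => W F = ∅)).Nonempty)
    (htau2 : ∃ T ⊆ Finset.Icc 1 n, T.card = 2 ∧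
      ∀ C ∈ 𝒻.filter (fun F => W F = ∅), (C ∩ T).Nonempty)
    (htau1 : ¬ ∃ x ∈ Finset.Icc 1 n, ∀ C ∈ 𝒻.filter (fun F => W F = ∅), x ∈ C) :
    7 ≤ (𝒻.filter (fun F => W F = ∅)).card := by
  have hdeg : ∀ x ∈ Finset.Icc 1 n, n - 1 ≤ (linkGraph 𝒻 x).card := fun x hx =>
    le_card_linkGraph (by omega) hsub hcard hVC hbig ih hx
  have hmem : ∀ C ∈ 𝒻.filter (fun F => W F = ∅), C ∈ 𝒻 := fun C hC => (Finset.mem_filter.1 hC).1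
  have hmeet : ∀ C ∈ 𝒻.filter (fun F => W F = ∅), ∀ F ∈ 𝒻, ∃ z ∈ C, z ∈ F := by
    intro C hC F hF
    obtain ⟨hC, hWC⟩ := Finset.mem_filter.1 hC
    have hne := (hW C hC).2.1 F hF
    rw [hWC] at hne
    obtain ⟨z, hz⟩ := Finset.nonempty_iff_ne_empty.2 hne
    exact ⟨z, (Finset.mem_inter.1 hz).2, (Finset.mem_inter.1 hz).1⟩
  have hcommon : ∀ A ∈ 𝒻.filter (fun F => W F = ∅), ∀ B ∈ 𝒻.filter (fun F => W F = ∅),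
      ∀ C ∈ 𝒻.filter (fun F => W F = ∅), ∃ z ∈ A, z ∈ B ∧ z ∈ C := fun A hA B hB C hC =>
    exists_common_of_pairwise_meet hn hsub hcard hVC hdeg (hmem A hA) (hmem B hB) (hmem C hC)
      (hmeet A hA) (hmeet B hB) (hmeet C hC)
  have hmiss : ∀ A ∈ 𝒻.filter (fun F => W F = ∅), ∀ z ∈ A,
      ∃ C ∈ 𝒻.filter (fun F => W F = ∅), z ∉ C := by
    intro A hA z hz
    by_contra! h
    exact htau1 ⟨z, hsub A (hmem A hA) hz, h⟩
  generalize 𝒻.filter (fun F => W F = ∅) = 𝒞 at *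
  exfalso
  obtain ⟨A, hA⟩ := hne
  obtain ⟨p, hpA⟩ : A.Nonempty := Finset.card_pos.1 (by rw [hcard A (hmem A hA)]; omega)
  obtain ⟨C, hC, hpC⟩ := hmiss A hA p hpA
  obtain ⟨q, hqA, hqC⟩ := hmeet A hA C (hmem C hC)
  obtain ⟨D, hD, hqD⟩ := hmiss A hA q hqA
  obtain ⟨a, haA, haC, haD⟩ := hcommon A hA C hC D hD
  obtain ⟨B, hB, haB⟩ := hmiss A hA a haA
  have hqp : q ≠ p := fun h => hpC (h ▸ hqC)
  have hap : a ≠ p := fun h => hpC (h ▸ haC)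
  have haq : a ≠ q := fun h => hqD (h ▸ haD)
  have hAmem : ∀ z ∈ A, z = p ∨ z = q ∨ z = a := by
    obtain ⟨a', -, -, rfl⟩ := exists_eq_triple_of_mem (hcard A (hmem A hA)) hpA hqA hqp.symm
    simp only [Finset.mem_insert, Finset.mem_singleton] at haA
    rw [(haA.resolve_left hap).resolve_left haq]
    simp
  have hqB : q ∈ B := by
    obtain ⟨z, hzA, hzB, hzC⟩ := hcommon A hA B hB C hC
    rcases hAmem z hzA with rfl | rfl | rfl <;> tauto
  have hpBD : p ∈ B ∧ p ∈ D := by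
    obtain ⟨z, hzA, hzB, hzD⟩ := hcommon A hA B hB D hD
    rcases hAmem z hzA with rfl | rfl | rfl <;> tauto
  obtain ⟨b, hbB, hbC, hbD⟩ := hcommon B hB C hC D hD
  have hbp : b ≠ p := fun h => hpC (h ▸ hbC)
  have hbq : b ≠ q := fun h => hqD (h ▸ hbD)
  have hba : b ≠ a := fun h => haB (h ▸ hbB)
  have htriple : ∀ X ∈ 𝒞, ∀ {u v w : ℕ}, u ∈ X → v ∈ X → w ∈ X → v ≠ u → w ≠ u → w ≠ v →
      ∀ F ∈ 𝒻, u ∈ F ∨ v ∈ F ∨ w ∈ F := by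
    intro X hX u v w hu hv hw hvu hwu hwv F hF
    obtain ⟨w', -, -, rfl⟩ := exists_eq_triple_of_mem (hcard X (hmem X hX)) hu hv hvu.symm
    simp only [Finset.mem_insert, Finset.mem_singleton] at hw
    rw [(hw.resolve_left hwu).resolve_left hwv]
    simpa using hmeet _ hX F hF
  exact not_meets_tetrahedron hn hcard hdeg (p := p) (q := q) (a := a) (b := b)
    (by simp; grind) (htriple A hA hpA hqA haA hqp hap haq)
    (htriple B hB hpBD.1 hqB hbB hqp hbp hbq) (htriple C hC hqC haC hbC haq hbq hba)
    (htriple D hD hpBD.2 haD hbD hap hbp hba)
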